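/- Let (A, [·,·], ∧) be a Gerstenhaber algebra, E the graded vector space with E_{−k} := A^k, 𝒩_k(P_1,…,P_k) := P_1∧⋯∧P_k, l_2(P_1,P_2) := (−1)^{|P_1|}[P_1,P_2], and l_i := ι_{l_2}𝒩_{i−1} for i > 2. Then for all m, n ≥ 2: [𝒩_m, l_n]_RN = binom(m+n−2, m) · l_{m+n−1}. -/

import Mathlib

open Finset

section Framework

variable {V : Type*} [AddCommGroup V] [Module ℝ V]

/-- The Koszul sign `ε(σ)` of a permutation `σ` acting on homogeneous elements whose
degrees are given by `d`. -/
def koszulSign {n : ℕ} (d : Fin n → ℤ) (σ : Equiv.Perm (Fin n)) : ℤ :=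
  ∏ p ∈ Finset.univ.filter (fun p : Fin n × Fin n => p.1 < p.2 ∧ σ p.2 < σ p.1),
    (-1 : ℤ) ^ (d (σ p.1) * d (σ p.2)).natAbs

/-- The `(k, n-k)`-unshuffles: permutations of `Fin n` which are increasing on the
first `k` indices and on the remaining ones. -/
def unshuffles (k n : ℕ) : Finset (Equiv.Perm (Fin n)) :=
  Finset.univ.filter (fun σ =>
    (∀ i j : Fin n, i < j → (j : ℕ) < k → σ i < σ j) ∧
    (∀ i j : Fin n, i < j → k ≤ (i : ℕ) → σ i < σ j))

/-- A (raw) vector valued `k`-form on the graded vector space with grading `𝒢`: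
it assigns, to homogeneous elements of degrees `d 0, …, d (k-1)`, an element of `V`. -/
abbrev GForm (𝒢 : ℤ → Submodule ℝ V) (k : ℕ) : Type _ :=
  (d : Fin k → ℤ) → ((i : Fin k) → 𝒢 (d i)) → V

/-- Transport of a vector valued form along an equality of arities. -/
def castForm {𝒢 : ℤ → Submodule ℝ V} {m n : ℕ} (h : m = n) (K : GForm 𝒢 m) : GForm 𝒢 n :=
  h ▸ K

variable (𝒢 : ℤ → Submodule ℝ V)

/-- Projection on the homogeneous component of degree `i`. -/
def prj [DirectSum.Decomposition 𝒢] (i : ℤ) (v : V) : 𝒢 i :=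
  DirectSum.decompose 𝒢 v i

/-- Insertion of a `k`-form `K` of degree `δK` into an `(l+1)`-form `L`:
`ι_K L (X_1,…,X_{k+l}) = Σ_{σ ∈ Sh(k,l)} ε(σ) L(K(X_{σ(1)},…,X_{σ(k)}), X_{σ(k+1)},…)`. -/
def insertPos [DirectSum.Decomposition 𝒢] {k l : ℕ} (δK : ℤ) (K : GForm 𝒢 k)
    (L : GForm 𝒢 (l + 1)) : GForm 𝒢 (k + l) := fun d x =>
  ∑ σ ∈ unshuffles k (k + l),
    koszulSign d σ •
      L (Fin.cons ((∑ i : Fin k, d (σ (Fin.castAdd l i))) + δK)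
          (fun j : Fin l => d (σ (Fin.natAdd k j))))
        (Fin.cons
          (prj 𝒢 ((∑ i : Fin k, d (σ (Fin.castAdd l i))) + δK)
            (K (fun i => d (σ (Fin.castAdd l i))) (fun i => x (σ (Fin.castAdd l i)))))
          (fun j : Fin l => x (σ (Fin.natAdd k j))))

/-- Insertion operator `ι_K L` of a `k`-form of degree `δK` into an `l`-form. -/
def insertionOp [DirectSum.Decomposition 𝒢] {k l : ℕ} (δK : ℤ) (K : GForm 𝒢 k) :
    GForm 𝒢 l → GForm 𝒢 (k + l - 1) :=
  match l with
  | 0 => fun _ => fun _ _ => 0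
  | _ + 1 => fun L => insertPos 𝒢 δK K L

/-- A formal sum of vector valued forms of all arities. -/
abbrev MultiForm : Type _ := (k : ℕ) → GForm 𝒢 k

/-- A single `k`-form seen as a formal sum concentrated in arity `k`. -/
def singleF (k : ℕ) (K : GForm 𝒢 k) : MultiForm 𝒢 :=
  fun n => if h : n = k then castForm h.symm K else 0

/-- The Richardson–Nijenhuis bracket `[K,L] = ι_K L - (-1)^{K̄ L̄} ι_L K` of formal
sums of forms `K` (of degree `δK`) and `L` (of degree `δL`), computed aritywise. -/
def rnBracketM [DirectSum.Decomposition 𝒢] (δK δL : ℤ) (K L : MultiForm 𝒢) : MultiForm 𝒢 :=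
  fun n =>
    (∑ p ∈ (Finset.range (n + 2)).attach,
      castForm (by have := Finset.mem_range.mp p.2; omega)
        (insertionOp 𝒢 δK (K p.1) (L (n + 1 - p.1))))
    - ((-1 : ℤ) ^ (δK * δL).natAbs) •
      (∑ p ∈ (Finset.range (n + 2)).attach,
        castForm (by have := Finset.mem_range.mp p.2; omega)
          (insertionOp 𝒢 δL (L p.1) (K (n + 1 - p.1))))

/-- `K` is a graded symmetric vector valued `k`-form of degree `δ`. -/
structure IsSymFormOfDeg {k : ℕ} (δ : ℤ) (K : GForm 𝒢 k) : Prop where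
  mem_grading : ∀ (d : Fin k → ℤ) (x : (i : Fin k) → 𝒢 (d i)), K d x ∈ 𝒢 ((∑ i, d i) + δ)
  map_add : ∀ (d : Fin k → ℤ) (x : (i : Fin k) → 𝒢 (d i)) (i : Fin k) (a b : 𝒢 (d i)),
    K d (Function.update x i (a + b)) = K d (Function.update x i a) + K d (Function.update x i b)
  map_smul : ∀ (d : Fin k → ℤ) (x : (i : Fin k) → 𝒢 (d i)) (i : Fin k) (c : ℝ) (a : 𝒢 (d i)),
    K d (Function.update x i (c • a)) = c • K d (Function.update x i a)
  symm : ∀ (d : Fin k → ℤ) (σ : Equiv.Perm (Fin k)) (x : (i : Fin k) → 𝒢 (d i)),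
    K (d ∘ σ) (fun i => x (σ i)) = koszulSign d σ • K d x

/-- The `L_∞` identities for a family `(l_i)` of symmetric vector valued forms of degree 1:
for each `n`, `Σ_{i+j=n+1} Σ_{σ ∈ Sh(i,j-1)} ε(σ) l_j (l_i (X_σ(1),…), X_…) = 0`. -/
def LInftyIdentity [DirectSum.Decomposition 𝒢] (l : MultiForm 𝒢) : Prop :=
  ∀ n : ℕ,
    (∑ p ∈ (Finset.range (n + 2)).attach,
      castForm (by have := Finset.mem_range.mp p.2; omega)
        (insertionOp 𝒢 1 (l p.1) (l (n + 1 - p.1)))) = (0 : GForm 𝒢 n)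

end Framework

section Gerstenhaber

variable {V : Type*} [AddCommGroup V] [Module ℝ V]

/-- A Gerstenhaber algebra structure on a graded vector space `(V, 𝒜)`: a graded
commutative associative product `wedge` together with a graded Lie bracket on the
shifted space which is a degree `i` derivation in each argument. -/
structure Gerstenhaber (𝒜 : ℤ → Submodule ℝ V) : Type _ where
  wedge : V →ₗ[ℝ] V →ₗ[ℝ] V
  bracket : V →ₗ[ℝ] V →ₗ[ℝ] V
  wedge_mem : ∀ (i j : ℤ) (x y : V), x ∈ 𝒜 i → y ∈ 𝒜 j → wedge x y ∈ 𝒜 (i + j)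
  bracket_mem : ∀ (i j : ℤ) (x y : V), x ∈ 𝒜 i → y ∈ 𝒜 j → bracket x y ∈ 𝒜 (i + j - 1)
  wedge_assoc : ∀ x y z, wedge (wedge x y) z = wedge x (wedge y z)
  wedge_comm : ∀ (i j : ℤ) (x y : V), x ∈ 𝒜 i → y ∈ 𝒜 j →
    wedge x y = ((-1 : ℤ) ^ (i * j).natAbs) • wedge y x
  bracket_antisymm : ∀ (i j : ℤ) (x y : V), x ∈ 𝒜 i → y ∈ 𝒜 j →
    bracket x y = -(((-1 : ℤ) ^ ((i - 1) * (j - 1)).natAbs) • bracket y x)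
  jacobi : ∀ (i j : ℤ) (x y z : V), x ∈ 𝒜 i → y ∈ 𝒜 j →
    bracket x (bracket y z) = bracket (bracket x y) z
      + ((-1 : ℤ) ^ ((i - 1) * (j - 1)).natAbs) • bracket y (bracket x z)
  leibniz : ∀ (i j : ℤ) (x y z : V), x ∈ 𝒜 i → y ∈ 𝒜 j →
    bracket x (wedge y z) = wedge (bracket x y) z
      + ((-1 : ℤ) ^ ((i - 1) * j).natAbs) • wedge y (bracket x z)

variable {𝒜 : ℤ → Submodule ℝ V}

/-- The grading of the graded vector space `E` with `E_{-k} := A^k`. -/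
abbrev negG (𝒜 : ℤ → Submodule ℝ V) : ℤ → Submodule ℝ V := fun i => 𝒜 (-i)

/-- Iterated wedge product of `k+1` elements. -/
def wedgeAll (G : Gerstenhaber 𝒜) : {k : ℕ} → (Fin (k + 1) → V) → V
  | 0, x => x 0
  | _ + 1, x => G.wedge (x 0) (wedgeAll G (fun i => x i.succ))

/-- The symmetric vector valued `k`-form `𝒩_k (P_1, …, P_k) := P_1 ∧ ⋯ ∧ P_k`. -/
def mathcalN (G : Gerstenhaber 𝒜) (𝒢 : ℤ → Submodule ℝ V) : (k : ℕ) → GForm 𝒢 k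
  | 0 => fun _ _ => 0
  | _ + 1 => fun _ x => wedgeAll G (fun i => (x i : V))

/-- The symmetric vector valued 2-form `l_2 (P_1, P_2) := (-1)^{|P_1|} [P_1, P_2]`. -/
def l2G (G : Gerstenhaber 𝒜) (𝒢 : ℤ → Submodule ℝ V) : GForm 𝒢 2 :=
  fun d x => ((-1 : ℤ) ^ (d 0).natAbs) • G.bracket (x 0) (x 1)

/-- The family `l_1 := 0`, `l_2`, and `l_i := ι_{l_2} 𝒩_{i-1}` for `i > 2`. -/
def lFormsG (G : Gerstenhaber 𝒜) (𝒢 : ℤ → Submodule ℝ V) [DirectSum.Decomposition 𝒢] :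
    (i : ℕ) → GForm 𝒢 i
  | 0 => 0
  | 1 => 0
  | 2 => l2G G 𝒢
  | i + 3 => castForm (by omega) (insertionOp 𝒢 1 (l2G G 𝒢) (mathcalN G 𝒢 (i + 2)))

end Gerstenhaber

section Signs

/-- The sign `(-1)^n`. -/
def paritySign (n : ℤ) : ℤ := (-1) ^ n.natAbs

theorem paritySign_eq_ite (n : ℤ) : paritySign n = if Even n then 1 else -1 := by
  unfold paritySign
  split_ifs with h
  · exact (Int.natAbs_even.mpr h).neg_one_pow
  · exact (Int.natAbs_odd.mpr (Int.not_even_iff_odd.mp h)).neg_one_pow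

theorem paritySign_add (a b : ℤ) : paritySign (a + b) = paritySign a * paritySign b := by
  simp only [paritySign_eq_ite, Int.even_add]
  split_ifs <;> simp_all

theorem paritySign_mul_self (a : ℤ) : paritySign a * paritySign a = 1 := by
  rw [paritySign_eq_ite]; split_ifs <;> simp

@[simp] theorem paritySign_zero : paritySign 0 = 1 := rfl

variable {ι : Type*} [LinearOrder ι] (d : ι → ℤ)

/-- The Koszul sign produced by sorting the two-letter word `i j`. -/
def swapSign (i j : ι) : ℤ := if j < i then paritySign (d i * d j) else 1

/-- The Koszul sign produced by sorting a word on `A` followed by a word on `B`, relative to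
sorting the two words separately. -/
def crossSign (A B : Finset ι) : ℤ := ∏ a ∈ A, ∏ b ∈ B, swapSign d a b

/-- The Koszul sign produced by sorting a word. -/
def listSign : List ι → ℤ
  | [] => 1
  | i :: l => (l.map (swapSign d i)).prod * listSign l

theorem swapSign_mul_self (i j : ι) : swapSign d i j * swapSign d i j = 1 := by
  unfold swapSign; split_ifs <;> simp [paritySign_mul_self]

theorem swapSign_self_of_lt {i j : ι} (h : i < j) : swapSign d i j = 1 := by
  simp [swapSign, h.not_gt]

theorem swapSign_mul_swapSign {i j : ι} (h : i ≠ j) :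
    swapSign d i j * swapSign d j i = paritySign (d i * d j) := by
  rcases lt_or_gt_of_ne h with h | h <;> simp [swapSign, h, h.not_gt, mul_comm]

theorem crossSign_mul_self (A B : Finset ι) : crossSign d A B * crossSign d A B = 1 := by
  simp [crossSign, ← Finset.prod_mul_distrib, swapSign_mul_self]

theorem crossSign_singleton (i j : ι) : crossSign d {i} {j} = swapSign d i j := by
  simp [crossSign]

theorem crossSign_empty_right (A : Finset ι) : crossSign d A ∅ = 1 := by
  simp [crossSign]

theorem crossSign_union_left {A B : Finset ι} (C : Finset ι) (h : Disjoint A B) :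
    crossSign d (A ∪ B) C = crossSign d A C * crossSign d B C := by
  simp [crossSign, Finset.prod_union h]

theorem crossSign_union_right (A : Finset ι) {B C : Finset ι} (h : Disjoint B C) :
    crossSign d A (B ∪ C) = crossSign d A B * crossSign d A C := by
  simp [crossSign, Finset.prod_union h, Finset.prod_mul_distrib]

theorem paritySign_sum_mul (A : Finset ι) (n : ℤ) :
    paritySign ((∑ a ∈ A, d a) * n) = ∏ a ∈ A, paritySign (d a * n) := by
  induction A using Finset.induction_on with
  | empty => simp
  | insert a A ha ih => rw [Finset.sum_insert ha, Finset.prod_insert ha, add_mul, paritySign_add, ih]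

theorem crossSign_mul_crossSign_singleton {A : Finset ι} {j : ι} (h : j ∉ A) :
    crossSign d A {j} * crossSign d {j} A = paritySign ((∑ a ∈ A, d a) * d j) := by
  simp only [crossSign, Finset.prod_singleton]
  rw [paritySign_sum_mul, ← Finset.prod_mul_distrib]
  exact Finset.prod_congr rfl fun a ha =>
    swapSign_mul_swapSign d (ne_of_mem_of_not_mem ha h)

theorem listSign_append (l l' : List ι) :
    listSign d (l ++ l') =
      listSign d l * listSign d l' * (l.map fun i => (l'.map (swapSign d i)).prod).prod := by
  induction l with
  | nil => simp [listSign]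
  | cons i l ih => simp only [List.cons_append, listSign, List.map_append, List.prod_append, ih,
      List.map_cons, List.prod_cons]; ring

theorem listSign_of_pairwise {l : List ι} (h : l.Pairwise (· < ·)) : listSign d l = 1 := by
  induction l with
  | nil => rfl
  | cons i l ih =>
    rw [List.pairwise_cons] at h
    rw [listSign, ih h.2, mul_one]
    apply List.prod_eq_one
    simp only [List.mem_map]
    rintro _ ⟨j, hj, rfl⟩
    exact swapSign_self_of_lt d (h.1 j hj)

theorem crossSign_toFinset {l l' : List ι} (h : l.Nodup) (h' : l'.Nodup) :
    crossSign d l.toFinset l'.toFinset = (l.map fun i => (l'.map (swapSign d i)).prod).prod := by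
  rw [crossSign, List.prod_toFinset _ h]
  simp only [List.prod_toFinset _ h']

variable {κ : Type*} [LinearOrder κ]

theorem swapSign_comp {e : κ → ι} (he : StrictMono e) (i j : κ) :
    swapSign (d ∘ e) i j = swapSign d (e i) (e j) := by
  simp [swapSign, he.lt_iff_lt]

theorem crossSign_comp {e : κ → ι} (he : StrictMono e) (A B : Finset κ) :
    crossSign (d ∘ e) A B = crossSign d (A.image e) (B.image e) := by
  simp only [crossSign, Finset.prod_image he.injective.injOn, swapSign_comp d he]

theorem listSign_map {e : κ → ι} (he : StrictMono e) (l : List κ) :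
    listSign d (l.map e) = listSign (d ∘ e) l := by
  induction l with
  | nil => rfl
  | cons i l ih =>
    simp only [List.map_cons, listSign, ih, List.map_map]
    congr 3
    funext j
    exact (swapSign_comp d he i j).symm

end Signs

section RightMultiplication

variable {V : Type*} [AddCommGroup V] [Module ℝ V] {𝒜 : ℤ → Submodule ℝ V} (G : Gerstenhaber 𝒜)

theorem Gerstenhaber.wedge_comm_neg {a b : ℤ} {x y : V} (hx : x ∈ 𝒜 (-a)) (hy : y ∈ 𝒜 (-b)) :
    G.wedge x y = paritySign (a * b) • G.wedge y x := by
  rw [G.wedge_comm _ _ x y hx hy, neg_mul_neg, paritySign]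

theorem Gerstenhaber.wedge_mem_neg {a b : ℤ} {x y : V} (hx : x ∈ 𝒜 (-a)) (hy : y ∈ 𝒜 (-b)) :
    G.wedge x y ∈ 𝒜 (-(a + b)) := by
  rw [neg_add]; exact G.wedge_mem _ _ x y hx hy

theorem Gerstenhaber.bracket_mem_neg {a b : ℤ} {x y : V} (hx : x ∈ 𝒜 (-a)) (hy : y ∈ 𝒜 (-b)) :
    G.bracket x y ∈ 𝒜 (-(a + b + 1)) := by
  rw [show -(a + b + 1) = -a + -b - 1 by ring]; exact G.bracket_mem _ _ x y hx hy

/-- The graded symmetry of `l₂`. -/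
theorem Gerstenhaber.paritySign_smul_bracket_comm {a b : ℤ} {x y : V}
    (hx : x ∈ 𝒜 (-a)) (hy : y ∈ 𝒜 (-b)) :
    paritySign a • G.bracket x y = (paritySign (a * b) * paritySign b) • G.bracket y x := by
  rw [G.bracket_antisymm _ _ x y hx hy, ← paritySign,
    show (-a - 1) * (-b - 1) = a * b + a + b + 1 by ring]
  simp only [paritySign_add, ← neg_smul, smul_smul]
  congr 1
  rw [show paritySign 1 = -1 from rfl]
  linear_combination (paritySign (a * b) * paritySign b) * paritySign_mul_self a

theorem Gerstenhaber.bracket_wedge_right {a b c : ℤ} {x y z : V}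
    (hx : x ∈ 𝒜 (-a)) (hy : y ∈ 𝒜 (-b)) (hz : z ∈ 𝒜 (-c)) :
    G.bracket x (G.wedge y z) =
      G.wedge (G.bracket x y) z + paritySign (b * c) • G.wedge (G.bracket x z) y := by
  rw [G.leibniz _ _ x y z hx hy, ← paritySign, G.wedge_comm_neg hy (G.bracket_mem_neg hx hz),
    smul_smul, ← paritySign_add]
  congr 2
  rw [show (-a - 1) * -b + b * (a + c + 1) = b * c + (a * b + b) + (a * b + b) by ring,
    paritySign_add, paritySign_add, mul_assoc, paritySign_mul_self, mul_one]

variable {ι : Type*}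

/-- Successive right multiplication by the letters of a word. -/
def mulList (x : ι → V) : List ι → V →ₗ[ℝ] V
  | [] => LinearMap.id
  | i :: l => mulList x l ∘ₗ G.wedge.flip (x i)

theorem mulList_append (x : ι → V) (l l' : List ι) :
    mulList G x (l ++ l') = mulList G x l' ∘ₗ mulList G x l := by
  induction l with
  | nil => rfl
  | cons i l ih => simp only [List.cons_append, mulList, ih, LinearMap.comp_assoc]

theorem mulList_map {κ : Type*} (x : ι → V) (e : κ → ι) (l : List κ) :
    mulList G x (l.map e) = mulList G (x ∘ e) l := by
  induction l with
  | nil => rfl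
  | cons i l ih => simp [mulList, ih]

theorem mulList_wedge (x : ι → V) (l : List ι) (u v : V) :
    mulList G x l (G.wedge u v) = G.wedge u (mulList G x l v) := by
  induction l generalizing v with
  | nil => rfl
  | cons i l ih => simp [mulList, G.wedge_assoc, ih]

theorem mulList_eq_zero {x : ι → V} {l : List ι} {i : ι} (hi : i ∈ l) (h : x i = 0) :
    mulList G x l = 0 := by
  induction l with
  | nil => simp at hi
  | cons j l ih =>
    rcases List.mem_cons.mp hi with rfl | hi
    · simp [mulList, h]
    · simp [mulList, ih hi]

variable [LinearOrder ι] {d : ι → ℤ} {x : ι → V}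

theorem listSign_smul_mulList_perm (hx : ∀ i, x i ∈ 𝒜 (-(d i))) {l l' : List ι} (h : l.Perm l') :
    listSign d l • mulList G x l = listSign d l' • mulList G x l' := by
  induction h with
  | nil => rfl
  | cons i h ih =>
    simp only [listSign, mulList, (h.map _).prod_eq, mul_smul, ← LinearMap.smul_comp, ih]
  | swap i j l =>
    ext v
    have key : G.wedge (G.wedge v (x j)) (x i)
        = paritySign (d j * d i) • G.wedge (G.wedge v (x i)) (x j) := by
      rw [G.wedge_assoc, G.wedge_comm_neg (hx j) (hx i), map_zsmul, G.wedge_assoc]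
    by_cases hij : i = j
    · rw [hij]
    simp only [listSign, mulList, List.map_cons, List.prod_cons, LinearMap.smul_apply,
      LinearMap.comp_apply, LinearMap.flip_apply, key, map_zsmul, smul_smul]
    congr 1
    rw [← swapSign_mul_swapSign d (Ne.symm hij)]
    linear_combination (swapSign d i j * (l.map (swapSign d i)).prod *
      (l.map (swapSign d j)).prod * listSign d l) * swapSign_mul_self d j i
  | trans _ _ ih ih' => exact ih.trans ih'

variable (d x)

/-- Right multiplication by the letters indexed by `S`, in increasing order. -/
noncomputable def rmul (S : Finset ι) : V →ₗ[ℝ] V := listSign d S.toList • mulList G x S.toList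

variable {d x}

theorem rmul_toFinset (hx : ∀ i, x i ∈ 𝒜 (-(d i))) {l : List ι} (hl : l.Nodup) :
    rmul G d x l.toFinset = listSign d l • mulList G x l :=
  listSign_smul_mulList_perm G hx (List.toFinset_toList hl)

theorem rmul_rmul (hx : ∀ i, x i ∈ 𝒜 (-(d i))) {A B : Finset ι} (h : Disjoint A B) (v : V) :
    rmul G d x B (rmul G d x A v) = crossSign d A B • rmul G d x (A ∪ B) v := by
  have hnd : (A.toList ++ B.toList).Nodup := by
    rw [List.nodup_append]
    exact ⟨A.nodup_toList, B.nodup_toList, fun a ha b hb =>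
      Finset.disjoint_iff_ne.mp h a (by simpa using ha) b (by simpa using hb)⟩
  have hu : A ∪ B = (A.toList ++ B.toList).toFinset := by simp
  have hc := crossSign_toFinset d A.nodup_toList B.nodup_toList
  rw [Finset.toList_toFinset, Finset.toList_toFinset] at hc
  rw [hu, rmul_toFinset G hx hnd, listSign_append, mulList_append, ← hc]
  simp only [rmul, LinearMap.smul_apply, LinearMap.comp_apply, map_zsmul, smul_smul]
  congr 1
  linear_combination (-listSign d A.toList * listSign d B.toList) * crossSign_mul_self d A B

@[simp] theorem rmul_empty : rmul G d x ∅ = LinearMap.id := by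
  simp [rmul, listSign, mulList]

@[simp] theorem rmul_singleton (i : ι) (v : V) : rmul G d x {i} v = G.wedge v (x i) := by
  simp [rmul, listSign, mulList]

theorem rmul_wedge (S : Finset ι) (u v : V) :
    rmul G d x S (G.wedge u v) = G.wedge u (rmul G d x S v) := by
  simp [rmul, mulList_wedge]

theorem rmul_eq_zero {S : Finset ι} {i : ι} (hi : i ∈ S) (h : x i = 0) : rmul G d x S = 0 := by
  rw [rmul, mulList_eq_zero G (Finset.mem_toList.mpr hi) h, smul_zero]

theorem rmul_mem (hx : ∀ i, x i ∈ 𝒜 (-(d i))) (S : Finset ι) {a : ℤ} {v : V}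
    (hv : v ∈ 𝒜 (-a)) : rmul G d x S v ∈ 𝒜 (-(a + ∑ i ∈ S, d i)) := by
  induction S using Finset.induction_on generalizing a v with
  | empty => simpa using hv
  | insert k S hk ih =>
    have h := rmul_rmul G hx (Finset.disjoint_singleton_left.mpr hk) v
    rw [rmul_singleton] at h
    rw [Finset.sum_insert hk, ← add_assoc, Finset.insert_eq,
      ← one_smul ℤ (rmul G d x _ v), ← crossSign_mul_self d {k} S, mul_smul, ← h]
    exact zsmul_mem (ih (G.wedge_mem_neg hv (hx k))) _

theorem rmul_comp {κ : Type*} [LinearOrder κ] (hx : ∀ i, x i ∈ 𝒜 (-(d i))) {e : κ → ι}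
    (he : StrictMono e) (S : Finset κ) :
    rmul G (d ∘ e) (x ∘ e) S = rmul G d x (S.image e) := by
  have h : S.image e = (S.toList.map e).toFinset := by ext; simp
  rw [h, rmul_toFinset G hx (S.nodup_toList.map he.injective), listSign_map d he, mulList_map, rmul]

/-- `[y, -]` is a derivation of iterated products. -/
theorem bracket_rmul (hx : ∀ i, x i ∈ 𝒜 (-(d i))) (S : Finset ι) {a b : ℤ} {y v : V}
    (hy : y ∈ 𝒜 (-b)) (hv : v ∈ 𝒜 (-a)) :
    G.bracket y (rmul G d x S v) = rmul G d x S (G.bracket y v) +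
      ∑ i ∈ S, (crossSign d {i} (S.erase i) * paritySign (a * d i)) •
        rmul G d x (S.erase i) (G.wedge (G.bracket y (x i)) v) := by
  induction S using Finset.induction_on with
  | empty => simp
  | insert k S hk ih =>
    have hd : Disjoint S {k} := Finset.disjoint_singleton_right.mpr hk
    have split (u : V) : rmul G d x (insert k S) u =
        crossSign d S {k} • G.wedge (rmul G d x S u) (x k) := by
      rw [← rmul_singleton G (d := d) (x := x), rmul_rmul G hx hd, smul_smul, crossSign_mul_self,
        one_smul, Finset.union_comm, ← Finset.insert_eq]
    have hsum : ∀ i ∈ S, (crossSign d {i} ((insert k S).erase i) * paritySign (a * d i)) •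
        rmul G d x ((insert k S).erase i) (G.wedge (G.bracket y (x i)) v) =
        crossSign d S {k} • G.wedge ((crossSign d {i} (S.erase i) * paritySign (a * d i)) •
          rmul G d x (S.erase i) (G.wedge (G.bracket y (x i)) v)) (x k) := by
      intro i hi
      have hik : k ≠ i := fun h => hk (h ▸ hi)
      have hd' : Disjoint (S.erase i) {k} := by simp [hk]
      have he : (insert k S).erase i = S.erase i ∪ {k} := by
        rw [Finset.erase_insert_of_ne hik, Finset.insert_eq, Finset.union_comm]
      have hS : S = {i} ∪ S.erase i := by rw [← Finset.insert_eq, Finset.insert_erase hi]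
      have hc : crossSign d S {k} = crossSign d {i} {k} * crossSign d (S.erase i) {k} := by
        conv_lhs => rw [hS]
        exact crossSign_union_left d _ (by simp)
      rw [he, crossSign_union_right d _ hd', map_zsmul, LinearMap.smul_apply,
        ← rmul_singleton G (d := d) (x := x), rmul_rmul G hx hd', smul_smul, smul_smul, hc]
      congr 1
      linear_combination (-crossSign d {i} (S.erase i) * crossSign d {i} {k} *
        paritySign (a * d i)) * crossSign_mul_self d (S.erase i) {k}
    rw [split, map_zsmul, G.bracket_wedge_right hy (rmul_mem G hx S hv) (hx k), ih,
      Finset.sum_insert hk, Finset.sum_congr rfl hsum, Finset.erase_insert hk, split,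
      rmul_wedge, ← Finset.smul_sum, map_add, LinearMap.add_apply, map_sum, LinearMap.sum_apply,
      smul_add, smul_add, smul_smul, add_right_comm, ← add_assoc]
    congr 3
    rw [add_mul, paritySign_add, ← crossSign_mul_crossSign_singleton d hk]
    linear_combination (crossSign d {k} S * paritySign (a * d k)) * crossSign_mul_self d S {k}

end RightMultiplication

section PairSum

variable {V : Type*} [AddCommGroup V] [Module ℝ V] {𝒜 : ℤ → Submodule ℝ V} (G : Gerstenhaber 𝒜)
variable {ι : Type*} [LinearOrder ι] (d : ι → ℤ) (x : ι → V)

/-- The term `± l₂(x_i, x_j) ∧ x_R`, where the sign comes from sorting the word `i j R`. -/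
noncomputable def pairTerm (R : Finset ι) (i j : ι) : V :=
  (swapSign d i j * crossSign d {i} R * crossSign d {j} R) •
    rmul G d x R (paritySign (d i) • G.bracket (x i) (x j))

/-- The sum of all `± l₂(x_i, x_j) ∧ x_{S \ {i, j}}` for `i < j` in `S`. -/
noncomputable def pairSum (S : Finset ι) : V :=
  ∑ i ∈ S, ∑ j ∈ S, if i < j then pairTerm G d x ((S.erase i).erase j) i j else 0

variable {d x}

theorem pairTerm_comm (hx : ∀ i, x i ∈ 𝒜 (-(d i))) (R : Finset ι) {i j : ι} (hij : i ≠ j) :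
    pairTerm G d x R i j = pairTerm G d x R j i := by
  rw [pairTerm, pairTerm, G.paritySign_smul_bracket_comm (hx i) (hx j), ← swapSign_mul_swapSign d hij]
  simp only [map_zsmul, smul_smul]
  congr 1
  linear_combination (swapSign d j i * crossSign d {i} R * crossSign d {j} R *
    paritySign (d j)) * swapSign_mul_self d i j

theorem pairTerm_mem (hx : ∀ i, x i ∈ 𝒜 (-(d i))) (R : Finset ι) (i j : ι) :
    pairTerm G d x R i j ∈ 𝒜 (-(d i + d j + 1 + ∑ r ∈ R, d r)) :=
  zsmul_mem (rmul_mem G hx R (zsmul_mem (G.bracket_mem_neg (hx i) (hx j)) _)) _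

theorem pairSum_mem (hx : ∀ i, x i ∈ 𝒜 (-(d i))) (S : Finset ι) :
    pairSum G d x S ∈ 𝒜 (-(∑ i ∈ S, d i + 1)) := by
  refine Submodule.sum_mem _ fun i hi => Submodule.sum_mem _ fun j hj => ?_
  split_ifs with hij
  · have h := pairTerm_mem G hx ((S.erase i).erase j) i j
    rwa [show d i + d j + 1 + ∑ r ∈ (S.erase i).erase j, d r = ∑ i ∈ S, d i + 1 by
      rw [← Finset.add_sum_erase S d hi,
        ← Finset.add_sum_erase (S.erase i) d (Finset.mem_erase.mpr ⟨hij.ne', hj⟩)]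
      ring] at h
  · exact zero_mem _

theorem pairSum_eq_zero {S : Finset ι} {k : ι} (hk : k ∈ S) (h : x k = 0) :
    pairSum G d x S = 0 := by
  refine Finset.sum_eq_zero fun i _ => Finset.sum_eq_zero fun j _ => ?_
  split_ifs
  · rw [pairTerm]
    by_cases hi : k = i
    · simp [← hi, h]
    by_cases hj : k = j
    · simp [← hj, h]
    rw [rmul_eq_zero G (Finset.mem_erase.mpr ⟨hj, Finset.mem_erase.mpr ⟨hi, hk⟩⟩) h]
    simp
  · rfl

theorem pairTerm_comp {κ : Type*} [LinearOrder κ] (hx : ∀ i, x i ∈ 𝒜 (-(d i))) {e : κ → ι}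
    (he : StrictMono e) (R : Finset κ) (i j : κ) :
    pairTerm G (d ∘ e) (x ∘ e) R i j = pairTerm G d x (R.image e) (e i) (e j) := by
  simp only [pairTerm, swapSign_comp d he, crossSign_comp d he, rmul_comp G hx he,
    Finset.image_singleton, Function.comp_apply]

theorem pairSum_comp {κ : Type*} [LinearOrder κ] (hx : ∀ i, x i ∈ 𝒜 (-(d i))) {e : κ → ι}
    (he : StrictMono e) (S : Finset κ) :
    pairSum G (d ∘ e) (x ∘ e) S = pairSum G d x (S.image e) := by
  simp only [pairSum, Finset.sum_image he.injective.injOn, he.lt_iff_lt, pairTerm_comp G hx he,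
    Finset.image_erase he.injective]

theorem crossSign_smul_rmul_pairTerm (hx : ∀ i, x i ∈ 𝒜 (-(d i))) {R T : Finset ι} {i j : ι}
    (hij : i ≠ j) (hi : i ∉ R) (hj : j ∉ R) (hRT : Disjoint R T) :
    crossSign d (insert i (insert j R)) T • rmul G d x T (pairTerm G d x R i j) =
      pairTerm G d x (R ∪ T) i j := by
  rw [pairTerm, pairTerm, map_zsmul, rmul_rmul G hx hRT, Finset.insert_eq, Finset.insert_eq,
    crossSign_union_left d _ (by simp [hi, hij]), crossSign_union_left d _ (by simp [hj]),
    crossSign_union_right d _ hRT, crossSign_union_right d _ hRT]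
  simp only [smul_smul]
  congr 1
  linear_combination (swapSign d i j * crossSign d {i} R * crossSign d {j} R *
    crossSign d {i} T * crossSign d {j} T) * crossSign_mul_self d R T

/-- Multiplying all `± l₂(x_i, x_j) ∧ x_{S \ {i, j}}` by `x_T`. -/
theorem crossSign_smul_rmul_pairSum (hx : ∀ i, x i ∈ 𝒜 (-(d i))) {S T : Finset ι}
    (hST : Disjoint S T) :
    crossSign d S T • rmul G d x T (pairSum G d x S) =
      ∑ i ∈ S, ∑ j ∈ S, if i < j then pairTerm G d x (((S ∪ T).erase i).erase j) i j else 0 := by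
  simp only [pairSum, map_sum, Finset.smul_sum]
  refine Finset.sum_congr rfl fun i hi => Finset.sum_congr rfl fun j hj => ?_
  split_ifs with hij
  · have hj' : j ∈ S.erase i := Finset.mem_erase.mpr ⟨hij.ne', hj⟩
    have h := crossSign_smul_rmul_pairTerm G hx hij.ne (R := (S.erase i).erase j) (T := T)
      (by simp) (by simp)
      (hST.mono_left ((Finset.erase_subset _ _).trans (Finset.erase_subset _ _)))
    rw [Finset.insert_erase hj', Finset.insert_erase hi] at h
    rw [h, Finset.erase_union_distrib, Finset.erase_eq_of_notMem (Finset.disjoint_left.mp hST hi),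
      Finset.erase_union_distrib, Finset.erase_eq_of_notMem (Finset.disjoint_left.mp hST hj)]
  · simp

/-- Expansion of a pair sum along its smallest index. -/
theorem pairSum_insert_min (hx : ∀ i, x i ∈ 𝒜 (-(d i))) {Z : Finset ι} {k : ι}
    (hk : ∀ i ∈ Z, k < i) :
    pairSum G d x (insert k Z) =
      ∑ j ∈ Z, crossSign d {j} (Z.erase j) •
        rmul G d x (Z.erase j) (paritySign (d k) • G.bracket (x k) (x j)) +
      ∑ i ∈ Z, ∑ j ∈ Z, if i < j then
        (swapSign d i j * crossSign d {i} ((Z.erase i).erase j) *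
          crossSign d {j} ((Z.erase i).erase j) * paritySign (d k * (d i + d j))) •
        rmul G d x ((Z.erase i).erase j)
          (G.wedge (paritySign (d i) • G.bracket (x i) (x j)) (x k)) else 0 := by
  have hkZ : k ∉ Z := fun h => lt_irrefl _ (hk k h)
  have hmin {R : Finset ι} (hR : R ⊆ Z) : crossSign d {k} R = 1 := by
    rw [crossSign, Finset.prod_singleton]
    exact Finset.prod_eq_one fun i hi => swapSign_self_of_lt d (hk i (hR hi))
  rw [pairSum, Finset.sum_insert hkZ, Finset.sum_insert hkZ]
  simp only [lt_irrefl, if_false, zero_add]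
  congr 1
  · refine Finset.sum_congr rfl fun j hj => ?_
    rw [if_pos (hk j hj), Finset.erase_insert hkZ, pairTerm, swapSign_self_of_lt d (hk j hj),
      hmin (Finset.erase_subset _ _), one_mul, one_mul]
  · refine Finset.sum_congr rfl fun i hi => ?_
    rw [Finset.sum_insert hkZ, if_neg (hk i hi).not_gt, zero_add]
    refine Finset.sum_congr rfl fun j hj => ?_
    split_ifs with hij
    · have hki : k ≠ i := (hk i hi).ne
      have hkj : k ≠ j := (hk j hj).ne
      have hR : (Z.erase i).erase j ⊆ Z := (Finset.erase_subset _ _).trans (Finset.erase_subset _ _)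
      have hd : Disjoint {k} ((Z.erase i).erase j) :=
        Finset.disjoint_singleton_left.mpr fun h => hkZ (hR h)
      have hsw {i : ι} (hi : i ∈ Z) : swapSign d i k = paritySign (d k * d i) := by
        rw [swapSign, if_pos (hk i hi), mul_comm]
      rw [Finset.erase_insert_of_ne hki, Finset.erase_insert_of_ne hkj, pairTerm,
        ← rmul_singleton G (d := d) (x := x), rmul_rmul G hx hd, hmin hR, one_smul,
        Finset.insert_eq, crossSign_union_right d _ hd, crossSign_union_right d _ hd,
        crossSign_singleton, crossSign_singleton, hsw hi, hsw hj, mul_add, paritySign_add]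
      congr 1
      ring
    · rfl

variable (d x) in
/-- The product `x_S` of a nonempty family, written with `k ∈ S` in front. -/
noncomputable def prodFrom (S : Finset ι) (k : ι) : V :=
  crossSign d {k} (S.erase k) • rmul G d x (S.erase k) (x k)

theorem prodFrom_mem (hx : ∀ i, x i ∈ 𝒜 (-(d i))) {S : Finset ι} {k : ι} (hk : k ∈ S) :
    prodFrom G d x S k ∈ 𝒜 (-(∑ i ∈ S, d i)) := by
  rw [← Finset.add_sum_erase S d hk]
  exact zsmul_mem (rmul_mem G hx _ (hx k)) _

theorem wedge_prodFrom (hx : ∀ i, x i ∈ 𝒜 (-(d i))) {S : Finset ι} {k : ι} (hk : k ∈ S) (v : V) :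
    G.wedge v (prodFrom G d x S k) = rmul G d x S v := by
  have hd : Disjoint {k} (S.erase k) := by simp
  rw [prodFrom, map_zsmul, ← rmul_wedge, ← rmul_singleton G (d := d) (x := x),
    rmul_rmul G hx hd, smul_smul, crossSign_mul_self, one_smul, ← Finset.insert_eq,
    Finset.insert_erase hk]

theorem bracket_prodFrom (hx : ∀ i, x i ∈ 𝒜 (-(d i))) {S : Finset ι} {k : ι} (hk : k ∈ S) {b : ℤ}
    {y : V} (hy : y ∈ 𝒜 (-b)) :
    G.bracket y (prodFrom G d x S k) =
      ∑ i ∈ S, crossSign d {i} (S.erase i) • rmul G d x (S.erase i) (G.bracket y (x i)) := by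
  rw [prodFrom, map_zsmul, bracket_rmul G hx _ hy (hx k), smul_add, ← Finset.add_sum_erase S _ hk,
    Finset.smul_sum]
  congr 1
  refine Finset.sum_congr rfl fun i hi => ?_
  obtain ⟨hik, hiS⟩ := Finset.mem_erase.mp hi
  set R := (S.erase k).erase i with hR
  have hi' : S.erase k = {i} ∪ R := by rw [← Finset.insert_eq, hR, Finset.insert_erase hi]
  have hk' : S.erase i = {k} ∪ R := by
    rw [← Finset.insert_eq, hR, Finset.erase_right_comm,
      Finset.insert_erase (Finset.mem_erase.mpr ⟨hik.symm, hk⟩)]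
  have hiR : Disjoint {i} R := by simp [hR]
  have hkR : Disjoint {k} R := by simp [hR]
  have h := rmul_rmul G hx hkR (G.bracket y (x i))
  rw [rmul_singleton] at h
  rw [hi', hk', h, crossSign_union_right d _ hiR, crossSign_union_right d _ hkR,
    crossSign_singleton, crossSign_singleton, ← swapSign_mul_swapSign d hik.symm, smul_smul,
    smul_smul]
  congr 1
  linear_combination (crossSign d {i} R * swapSign d i k * crossSign d {k} R ^ 2) *
    swapSign_mul_self d k i + (crossSign d {i} R * swapSign d i k) * crossSign_mul_self d {k} R

/-- `l₂(-, x_j)` is a derivation of iterated products. -/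
theorem paritySign_smul_bracket_prodFrom (hx : ∀ i, x i ∈ 𝒜 (-(d i))) {S : Finset ι} {k : ι}
    (hk : k ∈ S) (j : ι) :
    paritySign (∑ i ∈ S, d i) • G.bracket (prodFrom G d x S k) (x j) =
      ∑ i ∈ S, (crossSign d {i} (S.erase i) * paritySign ((∑ r ∈ S.erase i, d r) * d j)) •
        rmul G d x (S.erase i) (paritySign (d i) • G.bracket (x i) (x j)) := by
  rw [G.paritySign_smul_bracket_comm (prodFrom_mem G hx hk) (hx j), bracket_prodFrom G hx hk (hx j),
    Finset.smul_sum]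
  refine Finset.sum_congr rfl fun i hi => ?_
  rw [G.paritySign_smul_bracket_comm (hx i) (hx j), map_zsmul, smul_smul, smul_smul,
    ← Finset.add_sum_erase S d hi, add_mul, paritySign_add]
  congr 1
  ring

theorem crossSign_smul_rmul_rmul_bracket (hx : ∀ i, x i ∈ 𝒜 (-(d i))) {S T : Finset ι} {i j : ι}
    (hi : i ∉ S) (hj : j ∉ T) (hjS : j ∉ S) (hST : Disjoint S T) :
    (crossSign d (insert i S) (insert j T) * crossSign d {j} T * crossSign d {i} S *
      paritySign ((∑ r ∈ S, d r) * d j)) •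
        rmul G d x T (rmul G d x S (paritySign (d i) • G.bracket (x i) (x j))) =
      pairTerm G d x (S ∪ T) i j := by
  rw [pairTerm, rmul_rmul G hx hST, ← crossSign_mul_crossSign_singleton d hjS, Finset.insert_eq,
    Finset.insert_eq, crossSign_union_left d _ (by simpa using hi),
    crossSign_union_right d _ (by simpa using hj), crossSign_union_right d _ (by simpa using hj),
    crossSign_union_right d _ hST, crossSign_union_right d _ hST, crossSign_singleton, smul_smul]
  congr 1
  have h₁ := crossSign_mul_self d S {j}
  have h₂ := crossSign_mul_self d S T
  have h₃ := crossSign_mul_self d {j} T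
  generalize crossSign d S {j} = a at *
  generalize crossSign d S T = b at *
  generalize crossSign d {j} T = c at *
  grind

/-- The part of `l(x_S, x_T)` in which `l₂` involves `x_S`. -/
theorem crossSign_smul_sum_rmul_bracket_prodFrom (hx : ∀ i, x i ∈ 𝒜 (-(d i))) {S T : Finset ι}
    {k : ι} (hk : k ∈ S) (hST : Disjoint S T) :
    crossSign d S T • ∑ j ∈ T, crossSign d {j} (T.erase j) • rmul G d x (T.erase j)
        (paritySign (∑ i ∈ S, d i) • G.bracket (prodFrom G d x S k) (x j)) =
      ∑ i ∈ S, ∑ j ∈ T, pairTerm G d x (((S ∪ T).erase i).erase j) i j := by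
  rw [Finset.sum_comm, Finset.smul_sum]
  refine Finset.sum_congr rfl fun j hj => ?_
  rw [paritySign_smul_bracket_prodFrom G hx hk, map_sum, Finset.smul_sum, Finset.smul_sum]
  refine Finset.sum_congr rfl fun i hi => ?_
  have hjS : j ∉ S := Finset.disjoint_right.mp hST hj
  have hiT : i ∉ T := Finset.disjoint_left.mp hST hi
  have h := crossSign_smul_rmul_rmul_bracket G hx (S := S.erase i) (T := T.erase j) (i := i) (j := j)
    (by simp) (by simp) (fun h => hjS (Finset.mem_of_mem_erase h))
    (hST.mono (Finset.erase_subset _ _) (Finset.erase_subset _ _))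
  rw [Finset.insert_erase hi, Finset.insert_erase hj] at h
  rw [Finset.erase_union_distrib, Finset.erase_eq_of_notMem hiT, Finset.erase_union_distrib,
    Finset.erase_eq_of_notMem (fun h => hjS (Finset.mem_of_mem_erase h)), ← h, map_zsmul, smul_smul,
    smul_smul]
  congr 1
  ring

theorem crossSign_smul_rmul_wedge_prodFrom (hx : ∀ i, x i ∈ 𝒜 (-(d i))) {S R : Finset ι}
    {i j k : ι} (hk : k ∈ S) (hij : i ≠ j) (hi : i ∉ R) (hj : j ∉ R) (hiS : i ∉ S) (hjS : j ∉ S)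
    (hSR : Disjoint S R) :
    crossSign d S (insert i (insert j R)) •
      (swapSign d i j * crossSign d {i} R * crossSign d {j} R *
        paritySign ((∑ r ∈ S, d r) * (d i + d j))) •
      rmul G d x R (G.wedge (paritySign (d i) • G.bracket (x i) (x j)) (prodFrom G d x S k)) =
      pairTerm G d x (S ∪ R) i j := by
  rw [pairTerm, wedge_prodFrom G hx hk, rmul_rmul G hx hSR, mul_add, paritySign_add,
    ← crossSign_mul_crossSign_singleton d hiS, ← crossSign_mul_crossSign_singleton d hjS,
    Finset.insert_eq, Finset.insert_eq, crossSign_union_right d S (by simp [hi, hij]),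
    crossSign_union_right d S (by simpa using hj), crossSign_union_right d _ hSR,
    crossSign_union_right d _ hSR, smul_smul, smul_smul]
  congr 1
  have h₁ := crossSign_mul_self d S {i}
  have h₂ := crossSign_mul_self d S {j}
  have h₃ := crossSign_mul_self d S R
  generalize crossSign d S {i} = a at *
  generalize crossSign d S {j} = b at *
  generalize crossSign d S R = c at *
  grind

/-- The part of `l(x_S, x_T)` in which `l₂` does not involve `x_S`. -/
theorem crossSign_smul_sum_rmul_wedge_prodFrom (hx : ∀ i, x i ∈ 𝒜 (-(d i))) {S T : Finset ι}
    {k : ι} (hk : k ∈ S) (hST : Disjoint S T) :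
    crossSign d S T • (∑ i ∈ T, ∑ j ∈ T, if i < j then
        (swapSign d i j * crossSign d {i} ((T.erase i).erase j) *
          crossSign d {j} ((T.erase i).erase j) * paritySign ((∑ r ∈ S, d r) * (d i + d j))) •
        rmul G d x ((T.erase i).erase j)
          (G.wedge (paritySign (d i) • G.bracket (x i) (x j)) (prodFrom G d x S k)) else 0) =
      ∑ i ∈ T, ∑ j ∈ T, if i < j then pairTerm G d x (((S ∪ T).erase i).erase j) i j else 0 := by
  simp only [Finset.smul_sum]
  refine Finset.sum_congr rfl fun i hi => Finset.sum_congr rfl fun j hj => ?_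
  split_ifs with hij
  · have hiS : i ∉ S := Finset.disjoint_right.mp hST hi
    have hjS : j ∉ S := Finset.disjoint_right.mp hST hj
    have hj' : j ∈ T.erase i := Finset.mem_erase.mpr ⟨hij.ne', hj⟩
    have h := crossSign_smul_rmul_wedge_prodFrom G hx hk hij.ne (R := (T.erase i).erase j)
      (by simp) (by simp) hiS hjS
      (hST.mono_right ((Finset.erase_subset _ _).trans (Finset.erase_subset _ _)))
    rw [Finset.insert_erase hj', Finset.insert_erase hi] at h
    rw [h, Finset.erase_union_distrib, Finset.erase_eq_of_notMem hiS, Finset.erase_union_distrib,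
      Finset.erase_eq_of_notMem hjS]
  · simp

end PairSum

section Unshuffles

/-- The set of the first `k` values of `σ`. -/
def leftSet {k l : ℕ} (σ : Equiv.Perm (Fin (k + l))) : Finset (Fin (k + l)) :=
  Finset.univ.image fun i : Fin k => σ (Fin.castAdd l i)

theorem compl_leftSet {k l : ℕ} (σ : Equiv.Perm (Fin (k + l))) :
    (leftSet σ)ᶜ = Finset.univ.image fun j : Fin l => σ (Fin.natAdd k j) := by
  ext a
  obtain ⟨b, rfl⟩ := σ.surjective a
  refine Fin.addCases (fun i => ?_) (fun j => ?_) b <;>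
    simp [leftSet, Fin.ext_iff] <;> intros <;> omega

theorem strictMono_castAdd {k l : ℕ} {σ : Equiv.Perm (Fin (k + l))}
    (hσ : σ ∈ unshuffles k (k + l)) : StrictMono fun i : Fin k => σ (Fin.castAdd l i) :=
  fun _ _ hij => (Finset.mem_filter.mp hσ).2.1 _ _ hij (by simp)

theorem strictMono_natAdd {k l : ℕ} {σ : Equiv.Perm (Fin (k + l))}
    (hσ : σ ∈ unshuffles k (k + l)) : StrictMono fun j : Fin l => σ (Fin.natAdd k j) :=
  fun _ _ hij => (Finset.mem_filter.mp hσ).2.2 _ _ (by simpa using hij) (by simp)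

theorem koszulSign_eq_prod {n : ℕ} (d : Fin n → ℤ) (σ : Equiv.Perm (Fin n)) :
    koszulSign d σ = ∏ p, ∏ q, if p < q then swapSign d (σ p) (σ q) else 1 := by
  rw [koszulSign, Finset.prod_filter, Fintype.prod_prod_type]
  refine Finset.prod_congr rfl fun p _ => Finset.prod_congr rfl fun q _ => ?_
  by_cases h : p < q <;> simp [h, swapSign, paritySign]

theorem koszulSign_of_mem_unshuffles {k l : ℕ} (d : Fin (k + l) → ℤ)
    {σ : Equiv.Perm (Fin (k + l))} (hσ : σ ∈ unshuffles k (k + l)) :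
    koszulSign d σ = crossSign d (leftSet σ) (leftSet σ)ᶜ := by
  have hl := strictMono_castAdd hσ
  have hr := strictMono_natAdd hσ
  have h₁ (i j : Fin k) : (if Fin.castAdd l i < Fin.castAdd l j then
      swapSign d (σ (Fin.castAdd l i)) (σ (Fin.castAdd l j)) else 1) = 1 := by
    split_ifs with h
    · exact swapSign_self_of_lt d (hl h)
    · rfl
  have h₂ (i j : Fin l) : (if Fin.natAdd k i < Fin.natAdd k j then
      swapSign d (σ (Fin.natAdd k i)) (σ (Fin.natAdd k j)) else 1) = 1 := by
    split_ifs with h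
    · exact swapSign_self_of_lt d (hr (by simpa using h))
    · rfl
  have h₃ (i : Fin k) (j : Fin l) : Fin.castAdd l i < Fin.natAdd k j := by
    rw [Fin.lt_def, Fin.val_castAdd, Fin.val_natAdd]; omega
  rw [koszulSign_eq_prod, Fin.prod_univ_add, compl_leftSet, leftSet, crossSign,
    Finset.prod_image hl.injective.injOn]
  simp only [Fin.prod_univ_add, h₁, h₂, h₃, (h₃ _ _).not_gt, if_true, if_false,
    Finset.prod_const_one, one_mul, mul_one, Finset.prod_image hr.injective.injOn]

theorem card_leftSet {k l : ℕ} (σ : Equiv.Perm (Fin (k + l))) : (leftSet σ).card = k := by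
  have h : Function.Injective fun i : Fin k => σ (Fin.castAdd l i) :=
    σ.injective.comp (Fin.castAdd_injective k l)
  rw [leftSet, Finset.card_image_of_injective _ h, Finset.card_univ, Fintype.card_fin]

theorem leftSet_injOn (k l : ℕ) : Set.InjOn (leftSet (k := k) (l := l)) (unshuffles k (k + l)) := by
  intro σ hσ τ hτ h
  have h' : (leftSet σ)ᶜ = (leftSet τ)ᶜ := by rw [h]
  rw [compl_leftSet, compl_leftSet] at h'
  rw [leftSet, leftSet] at h
  have hl := ((strictMono_castAdd hσ).range_inj (strictMono_castAdd hτ)).mp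
    (by simpa using Finset.coe_inj.mpr h)
  have hr := ((strictMono_natAdd hσ).range_inj (strictMono_natAdd hτ)).mp
    (by simpa using Finset.coe_inj.mpr h')
  ext b : 1
  exact Fin.addCases (fun i => congrFun hl i) (fun j => congrFun hr j) b

theorem exists_leftSet_eq {k l : ℕ} {S : Finset (Fin (k + l))} (hS : S.card = k) :
    ∃ σ ∈ unshuffles k (k + l), leftSet σ = S := by
  have hS' : Sᶜ.card = l := by rw [Finset.card_compl, hS, Fintype.card_fin]; omega
  let σ : Equiv.Perm (Fin (k + l)) := finSumFinEquiv.symm.trans (finSumEquivOfFinset hS hS')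
  have hl (i : Fin k) : σ (Fin.castAdd l i) = S.orderEmbOfFin hS i := by simp [σ]
  have hr (j : Fin l) : σ (Fin.natAdd k j) = Sᶜ.orderEmbOfFin hS' j := by simp [σ]
  refine ⟨σ, ?_, ?_⟩
  · rw [unshuffles, Finset.mem_filter]
    refine ⟨Finset.mem_univ _, fun i j => ?_, fun i j => ?_⟩
    · refine Fin.addCases (fun i => ?_) (fun i => ?_) i <;>
        refine Fin.addCases (fun j => ?_) (fun j => ?_) j <;>
        intro hij hj
      · rw [hl, hl]; exact (S.orderEmbOfFin hS).strictMono hij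
      all_goals
        rw [Fin.lt_def] at hij
        simp only [Fin.val_castAdd, Fin.val_natAdd] at hij hj
        omega
    · refine Fin.addCases (fun i => ?_) (fun i => ?_) i <;>
        refine Fin.addCases (fun j => ?_) (fun j => ?_) j <;>
        intro hij hj
      case refine_2.refine_2 =>
        rw [hr, hr]
        exact (Sᶜ.orderEmbOfFin hS').strictMono (by simpa using hij)
      all_goals
        rw [Fin.lt_def] at hij
        simp only [Fin.val_castAdd, Fin.val_natAdd] at hij hj
        omega
  · rw [leftSet]
    simp only [hl]
    ext a
    simp

theorem sum_unshuffles {M : Type*} [AddCommMonoid M] (k l : ℕ) (f : Finset (Fin (k + l)) → M) :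
    ∑ σ ∈ unshuffles k (k + l), f (leftSet σ) = ∑ S ∈ Finset.univ.powersetCard k, f S := by
  refine Finset.sum_nbij leftSet (fun σ _ => ?_) (leftSet_injOn k l) (fun S hS => ?_)
    fun _ _ => rfl
  · exact Finset.mem_powersetCard_univ.mpr (card_leftSet σ)
  · obtain ⟨σ, hσ, h⟩ := exists_leftSet_eq (Finset.mem_powersetCard_univ.mp hS)
    exact ⟨σ, hσ, h⟩

theorem card_filter_powersetCard {α : Type*} [Fintype α] [DecidableEq α] {A B : Finset α}
    (hAB : Disjoint A B) {k : ℕ} (hk : A.card ≤ k) :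
    ((Finset.univ.powersetCard k).filter fun S => A ⊆ S ∧ Disjoint S B).card =
      (Fintype.card α - (A.card + B.card)).choose (k - A.card) := by
  rw [← Finset.card_union_of_disjoint hAB, ← Finset.card_compl, ← Finset.card_powersetCard]
  refine Finset.card_nbij' (· \ A) (· ∪ A) ?_ ?_ ?_ ?_
  · intro S hS
    simp only [Finset.coe_filter, Finset.mem_powersetCard_univ, Set.mem_ofPred_eq] at hS
    obtain ⟨hc, hA, hB⟩ := hS
    simp only [Finset.mem_coe, Finset.mem_powersetCard]
    refine ⟨fun a ha => ?_, by rw [Finset.card_sdiff_of_subset hA, hc]⟩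
    have := Finset.disjoint_left.mp hB (Finset.mem_sdiff.mp ha).1
    simp_all
  · intro S hS
    simp only [Finset.mem_coe, Finset.mem_powersetCard] at hS
    have hSA : Disjoint S A := Finset.disjoint_left.mpr fun a ha h => by
      simpa [h] using hS.1 ha
    have hSB : Disjoint S B := Finset.disjoint_left.mpr fun a ha h => by
      simpa [h] using hS.1 ha
    simp only [Finset.coe_filter, Finset.mem_powersetCard_univ, Set.mem_ofPred_eq,
      Finset.card_union_of_disjoint hSA, hS.2, Finset.disjoint_union_left]
    exact ⟨by omega, Finset.subset_union_right, hSB, hAB⟩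
  · intro S hS
    simp only [Finset.coe_filter, Set.mem_ofPred_eq] at hS
    exact Finset.sdiff_union_of_subset hS.2.1
  · intro S hS
    simp only [Finset.mem_coe, Finset.mem_powersetCard] at hS
    refine Finset.union_sdiff_cancel_right (Finset.disjoint_left.mpr fun a ha h => ?_)
    simpa [h] using hS.1 ha

variable {α M : Type*} [Fintype α] [DecidableEq α] [AddCommMonoid M]

/-- Double counting of the pairs contained in the `k`-element subsets. -/
theorem sum_powersetCard_sum_sum {k : ℕ} (hk : 2 ≤ k) (f : α → α → M) (hf : ∀ i, f i i = 0) :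
    ∑ S ∈ (Finset.univ : Finset α).powersetCard k, ∑ i ∈ S, ∑ j ∈ S, f i j =
      (Fintype.card α - 2).choose (k - 2) • ∑ i, ∑ j, f i j := by
  have h (S : Finset α) : ∑ i ∈ S, ∑ j ∈ S, f i j =
      ∑ i, ∑ j, if i ∈ S ∧ j ∈ S then f i j else 0 := by
    simp [ite_and, Finset.sum_ite_mem]
  simp only [h, Finset.smul_sum]
  rw [Finset.sum_comm]
  refine Finset.sum_congr rfl fun i _ => ?_
  rw [Finset.sum_comm]
  refine Finset.sum_congr rfl fun j _ => ?_
  by_cases hij : i = j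
  · simp [hij, hf]
  have hc := card_filter_powersetCard (A := {i, j}) (B := ∅) (by simp) (k := k)
    (by rwa [Finset.card_pair hij])
  rw [Finset.card_pair hij, Finset.card_empty, add_zero] at hc
  rw [← Finset.sum_filter, Finset.sum_const, ← hc]
  simp [Finset.insert_subset_iff]

theorem sum_powersetCard_sum_sum_compl {k : ℕ} (f : α → α → M) (hf : ∀ i, f i i = 0) :
    ∑ S ∈ (Finset.univ : Finset α).powersetCard k, ∑ i ∈ Sᶜ, ∑ j ∈ Sᶜ, f i j =
      (Fintype.card α - 2).choose k • ∑ i, ∑ j, f i j := by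
  have h (S : Finset α) : ∑ i ∈ Sᶜ, ∑ j ∈ Sᶜ, f i j =
      ∑ i, ∑ j, if i ∈ Sᶜ ∧ j ∈ Sᶜ then f i j else 0 := by
    simp only [ite_and, Finset.sum_ite_mem, Finset.univ_inter, Finset.sum_ite_irrel,
      Finset.sum_const_zero]
  simp only [h, Finset.smul_sum]
  rw [Finset.sum_comm]
  refine Finset.sum_congr rfl fun i _ => ?_
  rw [Finset.sum_comm]
  refine Finset.sum_congr rfl fun j _ => ?_
  by_cases hij : i = j
  · simp [hij, hf]
  have hc := card_filter_powersetCard (A := ∅) (B := {i, j}) (by simp) (k := k) (by simp)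
  rw [Finset.card_pair hij, Finset.card_empty, zero_add, Nat.sub_zero] at hc
  rw [← Finset.sum_filter, Finset.sum_const, ← hc]
  simp

theorem sum_powersetCard_sum_sum_mixed {k : ℕ} (hk : 1 ≤ k) (f : α → α → M) :
    ∑ S ∈ (Finset.univ : Finset α).powersetCard k, ∑ i ∈ S, ∑ j ∈ Sᶜ, f i j =
      (Fintype.card α - 2).choose (k - 1) • ∑ i, ∑ j, if i ≠ j then f i j else 0 := by
  have h (S : Finset α) : ∑ i ∈ S, ∑ j ∈ Sᶜ, f i j =
      ∑ i, ∑ j, if i ∈ S ∧ j ∈ Sᶜ then f i j else 0 := by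
    simp only [ite_and, Finset.sum_ite_mem, Finset.univ_inter, Finset.sum_ite_irrel,
      Finset.sum_const_zero]
  simp only [h, Finset.smul_sum]
  rw [Finset.sum_comm]
  refine Finset.sum_congr rfl fun i _ => ?_
  rw [Finset.sum_comm]
  refine Finset.sum_congr rfl fun j _ => ?_
  by_cases hij : i = j
  · simp [hij]
  have hc := card_filter_powersetCard (A := {i}) (B := {j}) (by simpa using hij) (k := k)
    (by simpa)
  rw [Finset.card_singleton, Finset.card_singleton] at hc
  rw [← Finset.sum_filter, Finset.sum_const, if_pos hij, ← hc]
  simp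

theorem sum_sum_ne_eq_two_nsmul {α M : Type*} [Fintype α] [LinearOrder α] [AddCommMonoid M]
    (f : α → α → M) (hf : ∀ i j, i ≠ j → f i j = f j i) :
    (∑ i, ∑ j, if i ≠ j then f i j else 0) = 2 • ∑ i, ∑ j, if i < j then f i j else 0 := by
  have h : (∑ i, ∑ j, if i < j then f i j else 0) = ∑ i, ∑ j, if j < i then f i j else 0 := by
    rw [Finset.sum_comm]
    refine Finset.sum_congr rfl fun i _ => Finset.sum_congr rfl fun j _ => ?_
    split_ifs with hij
    · exact hf _ _ hij.ne
    · rfl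
  rw [two_nsmul]
  conv_rhs => rw [h, ← h]
  conv_rhs => enter [2]; rw [h]
  simp only [← Finset.sum_add_distrib]
  refine Finset.sum_congr rfl fun i _ => Finset.sum_congr rfl fun j _ => ?_
  rcases lt_trichotomy i j with hij | rfl | hij
  · simp [hij, hij.ne, hij.not_gt]
  · simp
  · simp [hij, hij.ne', hij.not_gt]

end Unshuffles

section Forms

variable {V : Type*} [AddCommGroup V] [Module ℝ V] {𝒜 : ℤ → Submodule ℝ V} (G : Gerstenhaber 𝒜)

theorem wedgeAll_eq_mulList {l : ℕ} (y : Fin (l + 1) → V) :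
    wedgeAll G y = mulList G y ((List.finRange l).map Fin.succ) (y 0) := by
  induction l with
  | zero => rfl
  | succ l ih =>
    rw [wedgeAll, ih, mulList_map, mulList_map, ← mulList_wedge, List.finRange_succ, mulList,
      mulList_map]
    rfl

variable {ι : Type*} [LinearOrder ι] {d : ι → ℤ} {x : ι → V}

theorem wedgeAll_eq_rmul (hx : ∀ i, x i ∈ 𝒜 (-(d i))) {l : ℕ} {e : Fin l → ι} (he : StrictMono e)
    {y : Fin (l + 1) → V} (hy : ∀ j, y j.succ = x (e j)) :
    wedgeAll G y = rmul G d x (Finset.univ.image e) (y 0) := by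
  have hl : ((List.finRange l).map e).Pairwise (· < ·) :=
    (List.pairwise_lt_finRange l).map e fun _ _ h => he h
  have hu : Finset.univ.image e = ((List.finRange l).map e).toFinset := by ext; simp
  rw [hu, rmul_toFinset G hx (hl.imp ne_of_lt), listSign_of_pairwise d hl, one_smul,
    wedgeAll_eq_mulList, mulList_map, mulList_map]
  congr 2
  exact funext hy

theorem wedgeAll_comp_eq_prodFrom (hx : ∀ i, x i ∈ 𝒜 (-(d i))) {k : ℕ} {e : Fin (k + 1) → ι}
    (he : StrictMono e) :
    wedgeAll G (fun i => x (e i)) = prodFrom G d x (Finset.univ.image e) (e 0) := by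
  have h0 : (Finset.univ.image e).erase (e 0) =
      Finset.univ.image fun j : Fin k => e j.succ := by
    rw [← Finset.image_erase he.injective]
    ext a
    simp only [Finset.mem_image, Finset.mem_erase, Finset.mem_univ, and_true, true_and]
    constructor
    · rintro ⟨b, hb, rfl⟩
      exact ⟨b.pred hb, by rw [Fin.succ_pred]⟩
    · rintro ⟨b, rfl⟩
      exact ⟨_, b.succ_ne_zero, rfl⟩
  have he' : StrictMono fun j : Fin k => e j.succ := fun _ _ h => he (Fin.succ_lt_succ_iff.mpr h)
  rw [prodFrom, h0, wedgeAll_eq_rmul G hx he' (fun _ => rfl), crossSign, Finset.prod_singleton,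
    Finset.prod_eq_one, one_smul]
  intro a ha
  obtain ⟨j, -, rfl⟩ := Finset.mem_image.mp ha
  exact swapSign_self_of_lt d (he j.succ_pos)

/-- Expansion of a pair sum with an additional leading element `w` of degree `a`. -/
theorem pairSum_cons (hx : ∀ i, x i ∈ 𝒜 (-(d i))) {l : ℕ} {e : Fin l → ι} (he : StrictMono e)
    {δ : Fin (l + 1) → ℤ} {y : Fin (l + 1) → V} (hδ : ∀ j, δ j.succ = d (e j))
    (hy : ∀ j, y j.succ = x (e j)) (hy0 : y 0 ∈ 𝒜 (-(δ 0))) {a : ℤ} {w : V} (ha : δ 0 = a)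
    (hw : y 0 = w) :
    pairSum G δ y Finset.univ =
      ∑ j ∈ Finset.univ.image e, crossSign d {j} ((Finset.univ.image e).erase j) •
        rmul G d x ((Finset.univ.image e).erase j) (paritySign a • G.bracket w (x j)) +
      ∑ i ∈ Finset.univ.image e, ∑ j ∈ Finset.univ.image e, if i < j then
        (swapSign d i j * crossSign d {i} (((Finset.univ.image e).erase i).erase j) *
          crossSign d {j} (((Finset.univ.image e).erase i).erase j) *
          paritySign (a * (d i + d j))) •
        rmul G d x (((Finset.univ.image e).erase i).erase j)
          (G.wedge (paritySign (d i) • G.bracket (x i) (x j)) w) else 0 := by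
  subst ha hw
  have hyδ : ∀ i, y i ∈ 𝒜 (-(δ i)) := Fin.cases hy0 fun j => by rw [hδ, hy]; exact hx _
  have hs : StrictMono (Fin.succ : Fin l → Fin (l + 1)) := Fin.strictMono_succ
  have hδ' : δ ∘ Fin.succ = d ∘ e := funext hδ
  have hy' : y ∘ Fin.succ = x ∘ e := funext hy
  have hu : (Finset.univ : Finset (Fin (l + 1))) = insert 0 (Finset.univ.image Fin.succ) := by
    ext i; refine Fin.cases ?_ (fun j => ?_) i <;> simp
  have hrm (R : Finset (Fin l)) : rmul G δ y (R.image Fin.succ) = rmul G d x (R.image e) := by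
    rw [← rmul_comp G hyδ hs, ← rmul_comp G hx he, hδ', hy']
  have hcr (A B : Finset (Fin l)) : crossSign δ (A.image Fin.succ) (B.image Fin.succ) =
      crossSign d (A.image e) (B.image e) := by
    rw [← crossSign_comp _ hs, ← crossSign_comp _ he, hδ']
  have hcr' (i : Fin l) (B : Finset (Fin l)) : crossSign δ {i.succ} (B.image Fin.succ) =
      crossSign d {e i} (B.image e) := by
    simpa using hcr {i} B
  have hsw (i j : Fin l) : swapSign δ i.succ j.succ = swapSign d (e i) (e j) := by
    rw [← swapSign_comp _ hs, ← swapSign_comp _ he, hδ']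
  rw [hu, pairSum_insert_min G hyδ
    (by intro i hi; obtain ⟨j, -, rfl⟩ := Finset.mem_image.mp hi; exact j.succ_pos)]
  simp only [Finset.sum_image hs.injective.injOn, Finset.sum_image he.injective.injOn,
    ← Finset.image_erase hs.injective, ← Finset.image_erase he.injective, hrm, hcr', hsw, hδ, hy,
    he.lt_iff_lt, Fin.succ_lt_succ_iff]

/-- The form `K` is the sum of all `± l₂(x_i, x_j) ∧ x_{rest}`, `i < j`. -/
def IsPairSum {k : ℕ} (K : GForm (negG 𝒜) k) : Prop :=
  ∀ (d : Fin k → ℤ) (x : (i : Fin k) → negG 𝒜 (d i)),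
    K d x = pairSum G d (fun i => (x i : V)) Finset.univ

variable {G}

theorem IsPairSum.apply_eq_zero {n : ℕ} {L : GForm (negG 𝒜) n} (hL : IsPairSum G L)
    {d : Fin n → ℤ} {x : (i : Fin n) → negG 𝒜 (d i)} (i : Fin n) (hi : x i = 0) : L d x = 0 := by
  rw [hL]
  exact pairSum_eq_zero G (Finset.mem_univ i) (by simp [hi])

theorem mathcalN_apply_eq_zero {n : ℕ} {d : Fin (n + 1) → ℤ}
    {x : (i : Fin (n + 1)) → negG 𝒜 (d i)} (h : x 0 = 0) :
    mathcalN G (negG 𝒜) (n + 1) d x = 0 := by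
  refine (wedgeAll_eq_mulList G _).trans ?_
  rw [h]
  simp

theorem castForm_apply {𝒢 : ℤ → Submodule ℝ V} {m n : ℕ} (h : m = n) (K : GForm 𝒢 m)
    (d : Fin n → ℤ) (x : (i : Fin n) → 𝒢 (d i)) :
    castForm h K d x = K (d ∘ Fin.cast h) (fun i => x (Fin.cast h i)) := by
  subst h; rfl

theorem pairSum_comp_cast {m n : ℕ} (h : m = n) (d : Fin n → ℤ)
    (x : (i : Fin n) → negG 𝒜 (d i)) :
    pairSum G (d ∘ Fin.cast h) (fun i => (x (Fin.cast h i) : V)) Finset.univ =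
      pairSum G d (fun i => (x i : V)) Finset.univ := by
  subst h; rfl

theorem isPairSum_l2G : IsPairSum G (l2G G (negG 𝒜)) := by
  intro d x
  have h : ((Finset.univ : Finset (Fin 2)).erase 0).erase 1 = ∅ := by decide
  simp [l2G, pairSum, Fin.sum_univ_two, pairTerm, h, crossSign_empty_right, swapSign, paritySign]


section

variable {𝒢 : ℤ → Submodule ℝ V}

theorem castForm_zero {m n : ℕ} (h : m = n) : castForm h (0 : GForm 𝒢 m) = 0 := by
  subst h; rfl

theorem singleF_self (k : ℕ) (K : GForm 𝒢 k) : singleF 𝒢 k K k = K := by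
  simp [singleF, castForm]

theorem singleF_of_ne {k n : ℕ} (K : GForm 𝒢 k) (h : n ≠ k) : singleF 𝒢 k K n = 0 := by
  simp [singleF, h]

/-- `L` vanishes as soon as its first argument does. -/
def VanishesAtZero : {l : ℕ} → GForm 𝒢 l → Prop
  | 0, _ => True
  | _ + 1, L => ∀ d x, x 0 = 0 → L d x = 0

end

theorem IsPairSum.vanishesAtZero {n : ℕ} {L : GForm (negG 𝒜) n} (hL : IsPairSum G L) :
    VanishesAtZero L := by
  cases n with
  | zero => trivial
  | succ n => exact fun d x h => hL.apply_eq_zero 0 h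

theorem vanishesAtZero_mathcalN (n : ℕ) : VanishesAtZero (mathcalN G (negG 𝒜) n) := by
  cases n with
  | zero => trivial
  | succ n => exact fun d x h => mathcalN_apply_eq_zero h

variable [DirectSum.Decomposition (negG 𝒜)]

theorem coe_prj_of_mem {i : ℤ} {v : V} (hv : v ∈ 𝒜 (-i)) : (prj (negG 𝒜) i v : V) = v :=
  DirectSum.decompose_of_mem_same (negG 𝒜) hv

theorem IsPairSum.insertPos_mathcalN {k l : ℕ} (hk : 2 ≤ k) {K : GForm (negG 𝒜) k}
    (hK : IsPairSum G K) (d : Fin (k + l) → ℤ) (x : (i : Fin (k + l)) → negG 𝒜 (d i)) :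
    insertPos (negG 𝒜) 1 K (mathcalN G (negG 𝒜) (l + 1)) d x =
      (k + l - 2).choose (k - 2) • pairSum G d (fun i => (x i : V)) Finset.univ := by
  have hx : ∀ i, (x i : V) ∈ 𝒜 (-(d i)) := fun i => (x i).2
  have key : ∀ σ ∈ unshuffles k (k + l), koszulSign d σ •
      mathcalN G (negG 𝒜) (l + 1)
        (Fin.cons ((∑ i : Fin k, d (σ (Fin.castAdd l i))) + 1)
          (fun j : Fin l => d (σ (Fin.natAdd k j))))
        (Fin.cons
          (prj (negG 𝒜) ((∑ i : Fin k, d (σ (Fin.castAdd l i))) + 1)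
            (K (fun i => d (σ (Fin.castAdd l i))) (fun i => x (σ (Fin.castAdd l i)))))
          (fun j : Fin l => x (σ (Fin.natAdd k j)))) =
      ∑ i ∈ leftSet σ, ∑ j ∈ leftSet σ, if i < j then
        pairTerm G d (fun i => (x i : V)) ((Finset.univ.erase i).erase j) i j else 0 := by
    intro σ hσ
    have hl := strictMono_castAdd hσ
    rw [← Finset.union_compl (leftSet σ),
      ← crossSign_smul_rmul_pairSum G hx disjoint_compl_right, koszulSign_of_mem_unshuffles d hσ,
      compl_leftSet]
    refine congrArg (_ • ·)
      ((wedgeAll_eq_rmul G hx (strictMono_natAdd hσ) (fun _ => rfl)).trans (congrArg _ ?_))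
    refine (congrArg (fun v => (prj (negG 𝒜) _ v : V)) (hK _ _)).trans ?_
    rw [coe_prj_of_mem (pairSum_mem G (fun i => hx _) _)]
    exact pairSum_comp G hx hl _
  rw [insertPos, Finset.sum_congr rfl key, sum_unshuffles k l fun S => ∑ i ∈ S, ∑ j ∈ S,
    if i < j then pairTerm G d (fun i => (x i : V)) ((Finset.univ.erase i).erase j) i j else 0,
    sum_powersetCard_sum_sum hk _ (by simp), Fintype.card_fin, pairSum]

theorem IsPairSum.insertPos_of_mathcalN {k l : ℕ} {L : GForm (negG 𝒜) (l + 1)}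
    (hL : IsPairSum G L) (d : Fin (k + 1 + l) → ℤ) (x : (i : Fin (k + 1 + l)) → negG 𝒜 (d i)) :
    insertPos (negG 𝒜) 0 (mathcalN G (negG 𝒜) (k + 1)) L d x =
      (2 * (k + 1 + l - 2).choose k + (k + 1 + l - 2).choose (k + 1)) •
        pairSum G d (fun i => (x i : V)) Finset.univ := by
  have hx : ∀ i, (x i : V) ∈ 𝒜 (-(d i)) := fun i => (x i).2
  let f (i j : Fin (k + 1 + l)) : V :=
    pairTerm G d (fun i => (x i : V)) ((Finset.univ.erase i).erase j) i j
  have key : ∀ σ ∈ unshuffles (k + 1) (k + 1 + l), koszulSign d σ •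
      L (Fin.cons ((∑ i : Fin (k + 1), d (σ (Fin.castAdd l i))) + 0)
          (fun j : Fin l => d (σ (Fin.natAdd (k + 1) j))))
        (Fin.cons
          (prj (negG 𝒜) ((∑ i : Fin (k + 1), d (σ (Fin.castAdd l i))) + 0)
            (mathcalN G (negG 𝒜) (k + 1) (fun i => d (σ (Fin.castAdd l i)))
              (fun i => x (σ (Fin.castAdd l i)))))
          (fun j : Fin l => x (σ (Fin.natAdd (k + 1) j)))) =
      ∑ i ∈ leftSet σ, ∑ j ∈ (leftSet σ)ᶜ, f i j +
        ∑ i ∈ (leftSet σ)ᶜ, ∑ j ∈ (leftSet σ)ᶜ, if i < j then f i j else 0 := by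
    intro σ hσ
    have hl := strictMono_castAdd hσ
    have hk0 : σ (Fin.castAdd l 0) ∈ leftSet σ := Finset.mem_image_of_mem _ (Finset.mem_univ 0)
    have hsum : (∑ i : Fin (k + 1), d (σ (Fin.castAdd l i))) + 0 = ∑ i ∈ leftSet σ, d i := by
      rw [leftSet, Finset.sum_image hl.injective.injOn, add_zero]
    have hw : (prj (negG 𝒜) ((∑ i : Fin (k + 1), d (σ (Fin.castAdd l i))) + 0)
        (mathcalN G (negG 𝒜) (k + 1) (fun i => d (σ (Fin.castAdd l i)))
          (fun i => x (σ (Fin.castAdd l i)))) : V) =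
        prodFrom G d (fun i => (x i : V)) (leftSet σ) (σ (Fin.castAdd l 0)) := by
      refine (congrArg (fun v => (prj (negG 𝒜) _ v : V))
        (wedgeAll_comp_eq_prodFrom G hx hl)).trans (coe_prj_of_mem ?_)
      rw [hsum]
      exact prodFrom_mem G hx hk0
    refine (congrArg (koszulSign d σ • ·) ((hL _ _).trans (pairSum_cons G hx
      (strictMono_natAdd hσ) (fun _ => rfl) (fun _ => rfl) (SetLike.coe_mem _) hsum hw))).trans ?_
    simp only [← compl_leftSet]
    rw [koszulSign_of_mem_unshuffles d hσ, smul_add,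
      crossSign_smul_sum_rmul_bracket_prodFrom G hx hk0 disjoint_compl_right,
      crossSign_smul_sum_rmul_wedge_prodFrom G hx hk0 disjoint_compl_right, Finset.union_compl]
  have hf (i j : Fin (k + 1 + l)) (hij : i ≠ j) : f i j = f j i := by
    simp only [f]
    rw [Finset.erase_right_comm, pairTerm_comm G hx _ hij]
  rw [insertPos, Finset.sum_congr rfl key, sum_unshuffles (k + 1) l fun S => ∑ i ∈ S, ∑ j ∈ Sᶜ,
    f i j + ∑ i ∈ Sᶜ, ∑ j ∈ Sᶜ, if i < j then f i j else 0, Finset.sum_add_distrib,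
    sum_powersetCard_sum_sum_mixed (by omega), sum_powersetCard_sum_sum_compl _ (by simp),
    sum_sum_ne_eq_two_nsmul f hf, smul_smul, Fintype.card_fin, ← add_smul, pairSum,
    Nat.add_sub_cancel, mul_comm 2]

theorem isPairSum_lFormsG : ∀ {n : ℕ}, 2 ≤ n → IsPairSum G (lFormsG G (negG 𝒜) n)
  | 2, _ => isPairSum_l2G
  | n + 3, _ => by
    intro d x
    have hn : 2 + (n + 1) = n + 3 := by omega
    have h := isPairSum_l2G.insertPos_mathcalN (G := G) (l := n + 1) le_rfl (d ∘ Fin.cast hn)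
      (fun i => x (Fin.cast hn i))
    rw [Nat.sub_self, Nat.choose_zero_right, one_smul, pairSum_comp_cast] at h
    exact (castForm_apply hn (insertPos (negG 𝒜) 1 (l2G G (negG 𝒜))
      (mathcalN G (negG 𝒜) (n + 2))) d x).trans h

section Insertion

variable {𝒢 : ℤ → Submodule ℝ V} [DirectSum.Decomposition 𝒢]

theorem insertionOp_zero_right {k l : ℕ} (δ : ℤ) (K : GForm 𝒢 k) :
    insertionOp 𝒢 δ K (0 : GForm 𝒢 l) = 0 := by
  cases l with
  | zero => rfl
  | succ l => funext d x; simp [insertionOp, insertPos]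

theorem insertionOp_zero_left {k l : ℕ} (δ : ℤ) {L : GForm 𝒢 l} (hL : VanishesAtZero L) :
    insertionOp 𝒢 δ (0 : GForm 𝒢 k) L = 0 := by
  cases l with
  | zero => rfl
  | succ l =>
    funext d x
    refine Finset.sum_eq_zero fun σ _ => ?_
    rw [hL _ _ (show prj 𝒢 _ (0 : V) = 0 by simp [prj]), smul_zero]

theorem castForm_insertionOp_singleF_of_ne {k l p q n : ℕ} (h : p + q - 1 = n) (δ : ℤ)
    (K : GForm 𝒢 k) {L : GForm 𝒢 l} (hL : VanishesAtZero L) (hpq : p ≠ k ∨ q ≠ l) :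
    castForm h (insertionOp 𝒢 δ (singleF 𝒢 k K p) (singleF 𝒢 l L q)) = 0 := by
  by_cases hq : q = l
  · subst hq
    rw [singleF_of_ne K (by tauto), singleF_self, insertionOp_zero_left δ hL, castForm_zero]
  · rw [singleF_of_ne L hq, insertionOp_zero_right, castForm_zero]

theorem castForm_insertionOp_singleF_self {k l q n : ℕ} (h : k + q - 1 = n) (δ : ℤ)
    (K : GForm 𝒢 k) (L : GForm 𝒢 l) (hq : q = l) :
    castForm h (insertionOp 𝒢 δ (singleF 𝒢 k K k) (singleF 𝒢 l L q)) =
      castForm (hq ▸ h) (insertionOp 𝒢 δ K L) := by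
  subst hq
  rw [singleF_self, singleF_self]

/-- The insertion of a form concentrated in arity `k` into one concentrated in arity `l`. -/
theorem sum_castForm_insertionOp_singleF {k l : ℕ} (hl : 1 ≤ l) (δ : ℤ) (K : GForm 𝒢 k)
    {L : GForm 𝒢 l} (hL : VanishesAtZero L) (n : ℕ) :
    (∑ p ∈ (Finset.range (n + 2)).attach,
      castForm (by have := Finset.mem_range.mp p.2; omega)
        (insertionOp 𝒢 δ (singleF 𝒢 k K p.1) (singleF 𝒢 l L (n + 1 - p.1)))) =
      singleF 𝒢 (k + l - 1) (insertionOp 𝒢 δ K L) n := by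
  by_cases hn : n = k + l - 1
  · subst hn
    rw [singleF_self, Finset.sum_eq_single ⟨k, Finset.mem_range.mpr (by omega)⟩]
    · exact castForm_insertionOp_singleF_self _ δ K L (show k + l - 1 + 1 - k = l by omega)
    · rintro ⟨p, hp⟩ - hpk
      refine castForm_insertionOp_singleF_of_ne _ δ K hL (Or.inl fun h => hpk (by simpa using h))
    · simp
  · rw [singleF_of_ne _ hn]
    refine Finset.sum_eq_zero fun p _ => ?_
    have := Finset.mem_range.mp p.2
    exact castForm_insertionOp_singleF_of_ne _ δ K hL (by omega)

end Insertion

end Forms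

theorem two_mul_choose_add_choose_eq (a b : ℕ) :
    2 * (a + b + 1).choose (a + 1) + (a + b + 1).choose (a + 2) =
      (a + b + 2).choose (a + 2) + (a + b + 1).choose b := by
  rw [Nat.choose_succ_succ' (a + b + 1) (a + 1),
    ← Nat.choose_symm_of_eq_add (show a + b + 1 = (a + 1) + b by omega)]
  ring

/-- `[𝒩_m, l_n]_RN = binom(m+n-2, m) · l_{m+n-1}` for all `m, n ≥ 2`. -/
theorem rnBracket_mathcalN_lForms
    {V : Type*} [AddCommGroup V] [Module ℝ V] {𝒜 : ℤ → Submodule ℝ V}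
    (G : Gerstenhaber 𝒜) [DirectSum.Decomposition (negG 𝒜)]
    (m n : ℕ) (hm : 2 ≤ m) (hn : 2 ≤ n) :
    rnBracketM (negG 𝒜) 0 1 (singleF (negG 𝒜) m (mathcalN G (negG 𝒜) m))
        (singleF (negG 𝒜) n (lFormsG G (negG 𝒜) n))
      = (Nat.choose (m + n - 2) m) •
          singleF (negG 𝒜) (m + n - 1) (lFormsG G (negG 𝒜) (m + n - 1)) := by
  obtain ⟨a, rfl⟩ := Nat.exists_eq_add_of_le' hm
  obtain ⟨b, rfl⟩ := Nat.exists_eq_add_of_le' hn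
  have hL := isPairSum_lFormsG (G := G) hn
  have hL' := isPairSum_lFormsG (G := G) (n := a + 2 + (b + 2) - 1) (by omega)
  funext n
  rw [rnBracketM, sum_castForm_insertionOp_singleF (by omega) _ _ hL.vanishesAtZero,
    sum_castForm_insertionOp_singleF (by omega) _ _ (vanishesAtZero_mathcalN _), zero_mul,
    Int.natAbs_zero, pow_zero, one_smul, Pi.smul_apply]
  by_cases h : n = a + 2 + (b + 2) - 1
  · subst h
    rw [singleF_self, singleF_self]
    have hcomm : b + 2 + (a + 2) - 1 = a + 2 + (b + 2) - 1 := by omega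
    rw [singleF, dif_pos hcomm.symm]
    funext d x
    rw [Pi.sub_apply, Pi.sub_apply, castForm_apply, Pi.smul_apply, Pi.smul_apply, hL']
    have h₁ := hL.insertPos_of_mathcalN (k := a + 1) (l := b + 1) d x
    have h₂ := hL.insertPos_mathcalN (l := a + 1) (by omega) (d ∘ Fin.cast hcomm)
      (fun i => x (Fin.cast hcomm i))
    rw [pairSum_comp_cast] at h₂
    refine (congrArg₂ (· - ·) h₁ h₂).trans ?_
    rw [sub_eq_iff_eq_add]
    refine Eq.trans ?_ (add_smul _ _ _)
    congr 1
    rw [show a + 1 + 1 + (b + 1) - 2 = a + b + 1 by omega,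
      show a + 2 + (b + 2) - 2 = a + b + 2 by omega, show b + 2 + (a + 1) - 2 = a + b + 1 by omega,
      Nat.add_sub_cancel]
    exact two_mul_choose_add_choose_eq a b
  · rw [singleF_of_ne _ h, singleF_of_ne _ (by omega), singleF_of_ne _ h]
    simp
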